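/- Let n ≥ 1, T > 0, m_f ∈ ℝⁿ, let Σ_f be a symmetric positive definite n×n real matrix, and let σ denote the uniform probability measure on the unit sphere S^{n−1} = {θ ∈ ℝⁿ : ‖θ‖ = 1} (normalized rotation-invariant surface measure). Suppose m : [0, T) → ℝⁿ and Σ : [0, T) → (n×n real symmetric positive definite matrices) are differentiable and satisfy, for all t ∈ [0, T), m′(t) = −(1/(n(T − t)))(m(t) − m_f) and Σ′(t) = K(t) Σ(t) + Σ(t) K(t)ᵀ, where K(t) := (1/(T − t)) K̄(t) and K̄(t) := ∫_{S^{n−1}} sqrt((θᵀ Σ_f θ)/(θᵀ Σ(t) θ)) θ θᵀ σ(dθ) − (1/n) I_n. Define f : [0, T) → ℝ by f(t) := ∫_{S^{n−1}} [ (θᵀ(m(t) − m_f))² + ( sqrt(θᵀ Σ(t) θ) − sqrt(θᵀ Σ_f θ) )² ] σ(dθ). Then f is differentiable on [0, T) and, for every t ∈ [0, T), f′(t) = −(2/(T − t)) [ tr( K̄(t) Σ(t) K̄(t)ᵀ ) + (1/n²) ‖m(t) − m_f‖² ]. -/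

import Mathlib

open MeasureTheory Metric Matrix

/-- The uniform (normalized rotation-invariant) probability measure on the unit sphere
`S^{n-1} ⊆ ℝⁿ`. -/
noncomputable def sphereUniform (n : ℕ) :
    Measure (sphere (0 : EuclideanSpace ℝ (Fin n)) 1) :=
  ((volume : Measure (EuclideanSpace ℝ (Fin n))).toSphere Set.univ)⁻¹ •
    (volume : Measure (EuclideanSpace ℝ (Fin n))).toSphere

/-- The projection `θᵀ x` of `x ∈ ℝⁿ` onto the direction `θ` of the unit sphere. -/
noncomputable def sprj {n : ℕ} (θ : sphere (0 : EuclideanSpace ℝ (Fin n)) 1)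
    (x : EuclideanSpace ℝ (Fin n)) : ℝ :=
  ∑ i, (θ : EuclideanSpace ℝ (Fin n)) i * x i

/-- The quadratic form `θᵀ A θ` for a direction `θ` on the unit sphere. -/
noncomputable def squad {n : ℕ} (A : Matrix (Fin n) (Fin n) ℝ)
    (θ : sphere (0 : EuclideanSpace ℝ (Fin n)) 1) : ℝ :=
  ∑ i, ∑ j, (θ : EuclideanSpace ℝ (Fin n)) i * A i j * (θ : EuclideanSpace ℝ (Fin n)) j

/-- A linear isometry equivalence acting on the unit sphere. -/
noncomputable def sphAct {n : ℕ} (U : EuclideanSpace ℝ (Fin n) ≃ₗᵢ[ℝ] EuclideanSpace ℝ (Fin n))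
    (θ : sphere (0 : EuclideanSpace ℝ (Fin n)) 1) : sphere (0 : EuclideanSpace ℝ (Fin n)) 1 :=
  ⟨U θ, by simp⟩

lemma sphAct_continuous {n : ℕ}
    (U : EuclideanSpace ℝ (Fin n) ≃ₗᵢ[ℝ] EuclideanSpace ℝ (Fin n)) : Continuous (sphAct U) := by
  unfold sphAct
  exact Continuous.subtype_mk (U.continuous.comp continuous_subtype_val) _

open scoped Pointwise in
lemma sphAct_mp {n : ℕ} (U : EuclideanSpace ℝ (Fin n) ≃ₗᵢ[ℝ] EuclideanSpace ℝ (Fin n)) :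
    (sphereUniform n).map (sphAct U) = sphereUniform n := by
  unfold sphereUniform
  rw [Measure.map_smul]
  congr 1
  ext s hs
  have hm := (sphAct_continuous U).measurable
  rw [Measure.map_apply hm hs, Measure.toSphere_apply' _ (hm hs), Measure.toSphere_apply' _ hs]
  congr 1
  have h1 : (Set.Ioo (0:ℝ) 1 • (Subtype.val '' (sphAct U ⁻¹' s)))
      = U ⁻¹' (Set.Ioo (0:ℝ) 1 • (Subtype.val '' s)) := by
    ext x
    simp only [Set.mem_smul, Set.mem_image, Set.mem_preimage]
    constructor
    · rintro ⟨r, hr, _, ⟨y, hy, rfl⟩, rfl⟩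
      exact ⟨r, hr, _, ⟨_, hy, rfl⟩, by simp [sphAct]⟩
    · rintro ⟨r, hr, _, ⟨y, hy, rfl⟩, h⟩
      refine ⟨r, hr, _, ⟨⟨U.symm y, by simp⟩, ?_, rfl⟩, ?_⟩
      · have : sphAct U ⟨U.symm y, by simp⟩ = y := by ext1; simp [sphAct]
        rw [this]; exact hy
      · apply U.injective
        rw [← h]; simp
  rw [h1]
  exact U.measurePreserving.measure_preimage_emb U.toHomeomorph.measurableEmbedding _

lemma sphereUniform_prob (n : ℕ) (hn : 1 ≤ n) : IsProbabilityMeasure (sphereUniform n) := by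
  have : Nonempty (Fin n) := ⟨⟨0, hn⟩⟩
  have : Nontrivial (EuclideanSpace ℝ (Fin n)) := inferInstance
  constructor
  unfold sphereUniform
  rw [Measure.smul_apply, smul_eq_mul]
  refine ENNReal.inv_mul_cancel ?_ (measure_ne_top _ _)
  rw [Measure.measure_univ_ne_zero]
  exact Measure.toSphere_ne_zero _

lemma sph_integral_act {n : ℕ} (U : EuclideanSpace ℝ (Fin n) ≃ₗᵢ[ℝ] EuclideanSpace ℝ (Fin n))
    (g : sphere (0 : EuclideanSpace ℝ (Fin n)) 1 → ℝ) (hg : Continuous g) :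
    ∫ θ, g (sphAct U θ) ∂(sphereUniform n) = ∫ θ, g θ ∂(sphereUniform n) := by
  conv_rhs => rw [← sphAct_mp U]
  rw [integral_map (sphAct_continuous U).measurable.aemeasurable hg.aestronglyMeasurable]

lemma sph_cont {n : ℕ} (i : Fin n) :
    Continuous fun θ : sphere (0 : EuclideanSpace ℝ (Fin n)) 1 =>
      (θ : EuclideanSpace ℝ (Fin n)) i := by fun_prop

lemma sph_integrable {n : ℕ} (hn : 1 ≤ n) (g : sphere (0 : EuclideanSpace ℝ (Fin n)) 1 → ℝ)
    (hg : Continuous g) : Integrable g (sphereUniform n) := by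
  have := sphereUniform_prob n hn
  exact hg.integrable_of_hasCompactSupport (HasCompactSupport.of_compactSpace g)

lemma sph_isotropy {n : ℕ} (hn : 1 ≤ n) (i j : Fin n) :
    ∫ θ : sphere (0 : EuclideanSpace ℝ (Fin n)) 1,
      (θ : EuclideanSpace ℝ (Fin n)) i * (θ : EuclideanSpace ℝ (Fin n)) j ∂(sphereUniform n)
      = (1 / (n : ℝ)) * (if i = j then 1 else 0) := by
  have := sphereUniform_prob n hn
  have hc : ∀ k l : Fin n, Continuous fun θ : sphere (0 : EuclideanSpace ℝ (Fin n)) 1 =>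
      (θ : EuclideanSpace ℝ (Fin n)) k * (θ : EuclideanSpace ℝ (Fin n)) l := by
    intro k l; fun_prop
  by_cases hij : i = j
  · subst hij
    have h1 : ∀ k : Fin n, ∫ θ : sphere (0 : EuclideanSpace ℝ (Fin n)) 1,
      (θ : EuclideanSpace ℝ (Fin n)) k * (θ : EuclideanSpace ℝ (Fin n)) k ∂(sphereUniform n) =
      ∫ θ : sphere (0 : EuclideanSpace ℝ (Fin n)) 1,
      (θ : EuclideanSpace ℝ (Fin n)) i * (θ : EuclideanSpace ℝ (Fin n)) i ∂(sphereUniform n) := by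
      intro k
      rw [← sph_integral_act (LinearIsometryEquiv.piLpCongrLeft 2 ℝ ℝ (Equiv.swap i k)) _ (hc i i)]
      simp [sphAct, LinearIsometryEquiv.piLpCongrLeft_apply, Equiv.piCongrLeft']
    have h2 : ∑ k : Fin n, ∫ θ : sphere (0 : EuclideanSpace ℝ (Fin n)) 1,
      (θ : EuclideanSpace ℝ (Fin n)) k * (θ : EuclideanSpace ℝ (Fin n)) k ∂(sphereUniform n)
        = 1 := by
      rw [← integral_finsetSum _ (fun k _ => sph_integrable hn _ (hc k k))]
      have : ∀ θ : sphere (0 : EuclideanSpace ℝ (Fin n)) 1,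
        ∑ k, (θ : EuclideanSpace ℝ (Fin n)) k * (θ : EuclideanSpace ℝ (Fin n)) k = 1 := by
        intro θ
        have h := EuclideanSpace.real_norm_sq_eq (θ : EuclideanSpace ℝ (Fin n))
        rw [norm_eq_of_mem_sphere] at h
        simp only [← pow_two]; rw [← h]; norm_num
      simp [this]
    simp only [h1] at h2
    simp at h2
    have : (n:ℝ) ≠ 0 := by positivity
    rw [if_pos rfl, mul_one, eq_div_iff this]
    linarith
  · have h1 := sph_integral_act (LinearIsometryEquiv.piLpCongrRight 2
      (fun k : Fin n => if k = i then LinearIsometryEquiv.neg ℝ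
        else LinearIsometryEquiv.refl ℝ ℝ)) _ (hc i j)
    have hji : ¬ j = i := fun h => hij h.symm
    simp [sphAct, hji, integral_neg] at h1
    simp [hij]
    linarith

lemma squad_cont {n : ℕ} (A : Matrix (Fin n) (Fin n) ℝ) : Continuous (squad A) := by
  unfold squad; fun_prop

lemma squad_pos {n : ℕ} (A : Matrix (Fin n) (Fin n) ℝ) (hA : A.PosDef)
    (θ : sphere (0 : EuclideanSpace ℝ (Fin n)) 1) : 0 < squad A θ := by
  have h0 : (θ : EuclideanSpace ℝ (Fin n)).ofLp ≠ 0 := by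
    intro h
    have h1 : (θ : EuclideanSpace ℝ (Fin n)) = 0 := by
      ext i; simpa using congrFun h i
    have h2 := norm_eq_of_mem_sphere θ
    rw [h1] at h2; simp at h2
  have h := hA.dotProduct_mulVec_pos h0
  rw [star_trivial] at h
  have e : squad A θ = (θ : EuclideanSpace ℝ (Fin n)).ofLp ⬝ᵥ
      (A *ᵥ (θ : EuclideanSpace ℝ (Fin n)).ofLp) := by
    simp only [squad, dotProduct, mulVec, Finset.mul_sum, mul_assoc]
  rw [e]
  exact h

lemma squad_abs_le {n : ℕ} (A : Matrix (Fin n) (Fin n) ℝ)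
    (θ : sphere (0 : EuclideanSpace ℝ (Fin n)) 1) : |squad A θ| ≤ ∑ i, ∑ j, |A i j| := by
  have hb : ∀ i, |(θ : EuclideanSpace ℝ (Fin n)) i| ≤ 1 := by
    intro i
    have h := PiLp.norm_apply_le (θ : EuclideanSpace ℝ (Fin n)) i
    rw [norm_eq_of_mem_sphere] at h
    exact h
  unfold squad
  refine (Finset.abs_sum_le_sum_abs _ _).trans (Finset.sum_le_sum fun i _ => ?_)
  refine (Finset.abs_sum_le_sum_abs _ _).trans (Finset.sum_le_sum fun j _ => ?_)
  rw [abs_mul, abs_mul]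
  have h1 := hb i
  have h2 := hb j
  calc _ ≤ 1 * |A i j| * 1 := by gcongr
    _ = _ := by ring

lemma squad_deriv {n : ℕ} (S : ℝ → Matrix (Fin n) (Fin n) ℝ) (M : Matrix (Fin n) (Fin n) ℝ)
    (I : Set ℝ) (t : ℝ)
    (hS : ∀ i j : Fin n, HasDerivWithinAt (fun s => S s i j) (M i j) I t)
    (θ : sphere (0 : EuclideanSpace ℝ (Fin n)) 1) :
    HasDerivWithinAt (fun s => squad (S s) θ) (squad M θ) I t := by
  unfold squad
  exact HasDerivWithinAt.fun_sum fun i _ => HasDerivWithinAt.fun_sum fun j _ =>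
    ((hS i j).const_mul _).mul_const _

lemma scalar_bd (a b c : ℝ) (ha : 0 ≤ a) (hb : 0 < b) (hc : 0 ≤ c) :
    |(√a - c) ^ 2 - (√b - c) ^ 2| ≤ |a - b| * (1 + 2 * c / √b) := by
  have hsb : 0 < √b := Real.sqrt_pos.2 hb
  have hsa : 0 ≤ √a := Real.sqrt_nonneg a
  have h1 : (√a - c) ^ 2 - (√b - c) ^ 2 = (a - b) * (1 - 2 * c / (√a + √b)) := by
    have h2 : a = √a ^ 2 := (Real.sq_sqrt ha).symm
    have h3 : b = √b ^ 2 := (Real.sq_sqrt hb.le).symm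
    have h4 : a - b = (√a - √b) * (√a + √b) := by nlinarith
    rw [h4]
    have : √a + √b ≠ 0 := by positivity
    field_simp
    ring
  rw [h1, abs_mul]
  gcongr
  have h5 : 2 * c / (√a + √b) ≤ 2 * c / √b := by
    gcongr; linarith
  have h6 : 0 ≤ 2 * c / (√a + √b) := by positivity
  rw [abs_le]; constructor <;> linarith

open Filter Topology in
lemma cov_deriv {n : ℕ} (hn : 1 ≤ n) (S : ℝ → Matrix (Fin n) (Fin n) ℝ)
    (M Sf : Matrix (Fin n) (Fin n) ℝ)
    (I : Set ℝ) (t : ℝ) (ht : t ∈ I) (hpos : ∀ s ∈ I, (S s).PosDef)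
    (hS : ∀ i j : Fin n, HasDerivWithinAt (fun s => S s i j) (M i j) I t) :
    HasDerivWithinAt (fun s => ∫ θ : sphere (0 : EuclideanSpace ℝ (Fin n)) 1,
        (√(squad (S s) θ) - √(squad Sf θ)) ^ 2 ∂(sphereUniform n))
      (∫ θ : sphere (0 : EuclideanSpace ℝ (Fin n)) 1,
        (1 - √(squad Sf θ) / √(squad (S t) θ)) * squad M θ ∂(sphereUniform n)) I t := by
  have hq : ∀ θ, 0 < √(squad (S t) θ) := fun θ => Real.sqrt_pos.2 (squad_pos _ (hpos t ht) θ)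
  have hcont : ∀ A : Matrix (Fin n) (Fin n) ℝ,
      Continuous fun θ => √(squad A θ) := fun A => (squad_cont A).sqrt
  have hgc : ∀ s, Continuous fun θ => (√(squad (S s) θ) - √(squad Sf θ)) ^ 2 := fun s =>
    ((hcont _).sub (hcont _)).pow 2
  rw [hasDerivWithinAt_iff_tendsto_slope]
  have hslope : ∀ s, slope (fun s => ∫ θ : sphere (0 : EuclideanSpace ℝ (Fin n)) 1,
        (√(squad (S s) θ) - √(squad Sf θ)) ^ 2 ∂(sphereUniform n)) t s =
      ∫ θ : sphere (0 : EuclideanSpace ℝ (Fin n)) 1,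
        (s - t)⁻¹ * ((√(squad (S s) θ) - √(squad Sf θ)) ^ 2
          - (√(squad (S t) θ) - √(squad Sf θ)) ^ 2) ∂(sphereUniform n) := by
    intro s
    rw [integral_const_mul, integral_sub (sph_integrable hn _ (hgc s)) (sph_integrable hn _ (hgc t)),
      slope_def_field, div_eq_inv_mul]
  rw [tendsto_congr hslope]
  set C : ℝ := ∑ i, ∑ j, |M i j| with hC
  refine tendsto_integral_filter_of_dominated_convergence
    (fun θ => (C + 1) * (1 + 2 * √(squad Sf θ) / √(squad (S t) θ))) ?_ ?_ ?_ ?_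
  · exact Eventually.of_forall fun s =>
      (((hgc s).sub (hgc t)).const_mul _).aestronglyMeasurable
  · have h1 : Tendsto (fun s => ∑ i, ∑ j, |slope (fun s => S s i j) t s|) (𝓝[I \ {t}] t) (𝓝 C) :=
      tendsto_finsetSum _ fun i _ => tendsto_finsetSum _ fun j _ =>
        (hasDerivWithinAt_iff_tendsto_slope.1 (hS i j)).abs
    filter_upwards [h1.eventually (gt_mem_nhds (lt_add_one C)), self_mem_nhdsWithin] with s hs hsI
    refine Eventually.of_forall fun θ => ?_
    rw [Real.norm_eq_abs, abs_mul]
    have h2 := scalar_bd _ _ (√(squad Sf θ)) (squad_pos _ (hpos s hsI.1) θ).le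
      (squad_pos _ (hpos t ht) θ) (Real.sqrt_nonneg _)
    have h3 : |(s - t)⁻¹| * |squad (S s) θ - squad (S t) θ| ≤ C + 1 := by
      rw [← abs_mul]
      refine le_trans (le_of_eq ?_) ((squad_abs_le (fun i j => slope (fun s => S s i j) t s) θ).trans
        hs.le)
      congr 1
      unfold squad
      simp only [← Finset.sum_sub_distrib, Finset.mul_sum, slope_def_field]
      refine Finset.sum_congr rfl fun i _ => Finset.sum_congr rfl fun j _ => ?_
      ring
    have h4 : 0 ≤ 1 + 2 * √(squad Sf θ) / √(squad (S t) θ) := by positivity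
    calc _ ≤ |(s - t)⁻¹| * (|squad (S s) θ - squad (S t) θ| *
              (1 + 2 * √(squad Sf θ) / √(squad (S t) θ))) := by gcongr
      _ = (|(s - t)⁻¹| * |squad (S s) θ - squad (S t) θ|) *
              (1 + 2 * √(squad Sf θ) / √(squad (S t) θ)) := by ring
      _ ≤ _ := by gcongr
  · refine sph_integrable hn _ ?_
    exact continuous_const.mul (continuous_const.add
      ((continuous_const.mul (hcont _)).div (hcont _) fun θ => (hq θ).ne'))
  · refine Eventually.of_forall fun θ => ?_
    have h1 := (((squad_deriv S M I t hS θ).sqrt (squad_pos _ (hpos t ht) θ).ne').sub_const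
      (√(squad Sf θ))).pow 2
    have h2 := hasDerivWithinAt_iff_tendsto_slope.1 h1
    convert h2 using 2 with s
    · simp only [slope_def_field, Pi.pow_apply]; ring
    · have := (hq θ).ne'
      field_simp
      try norm_num
      try ring

lemma sum_isotropy {n : ℕ} (hn : 1 ≤ n) (x : EuclideanSpace ℝ (Fin n)) :
    ∫ θ : sphere (0 : EuclideanSpace ℝ (Fin n)) 1, (sprj θ x) ^ 2 ∂(sphereUniform n)
      = (1 / (n : ℝ)) * ‖x‖ ^ 2 := by
  have h : ∀ θ : sphere (0 : EuclideanSpace ℝ (Fin n)) 1, (sprj θ x) ^ 2 =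
      ∑ i, ∑ j, (x i * x j) *
        ((θ : EuclideanSpace ℝ (Fin n)) i * (θ : EuclideanSpace ℝ (Fin n)) j) := by
    intro θ
    rw [sprj, pow_two, Finset.sum_mul_sum]
    refine Finset.sum_congr rfl fun i _ => Finset.sum_congr rfl fun j _ => ?_
    ring
  simp only [h]
  rw [integral_finsetSum _ fun i _ => sph_integrable hn _ (by fun_prop)]
  rw [EuclideanSpace.real_norm_sq_eq, Finset.mul_sum]
  refine Finset.sum_congr rfl fun i _ => ?_
  rw [integral_finsetSum _ fun i _ => sph_integrable hn _ (by fun_prop)]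
  simp only [integral_const_mul, sph_isotropy hn]
  simp
  ring

lemma cov_integral {n : ℕ} (hn : 1 ≤ n) (A M Sf Kb : Matrix (Fin n) (Fin n) ℝ)
    (hA : A.PosDef) (hSf : Sf.PosDef)
    (hKb : ∀ i j : Fin n, Kb i j =
        (∫ θ : sphere (0 : EuclideanSpace ℝ (Fin n)) 1,
            Real.sqrt (squad Sf θ / squad A θ) *
              ((θ : EuclideanSpace ℝ (Fin n)) i * (θ : EuclideanSpace ℝ (Fin n)) j)
            ∂(sphereUniform n))
          - (1 / (n : ℝ)) * (if i = j then 1 else 0)) :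
    ∫ θ : sphere (0 : EuclideanSpace ℝ (Fin n)) 1,
        (1 - √(squad Sf θ) / √(squad A θ)) * squad M θ ∂(sphereUniform n)
      = - ∑ i, ∑ j, M i j * Kb i j := by
  have hc : Continuous fun θ : sphere (0 : EuclideanSpace ℝ (Fin n)) 1 =>
      √(squad Sf θ / squad A θ) :=
    ((squad_cont Sf).div (squad_cont A) fun θ => (squad_pos A hA θ).ne').sqrt
  have h : ∀ θ : sphere (0 : EuclideanSpace ℝ (Fin n)) 1,
      (1 - √(squad Sf θ) / √(squad A θ)) * squad M θ =
      ∑ i, ∑ j, M i j * ((θ : EuclideanSpace ℝ (Fin n)) i * (θ : EuclideanSpace ℝ (Fin n)) j -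
        √(squad Sf θ / squad A θ) *
        ((θ : EuclideanSpace ℝ (Fin n)) i * (θ : EuclideanSpace ℝ (Fin n)) j)) := by
    intro θ
    rw [← Real.sqrt_div (squad_pos Sf hSf θ).le, squad, squad, squad, Finset.mul_sum]
    refine Finset.sum_congr rfl fun i _ => ?_
    rw [Finset.mul_sum]
    refine Finset.sum_congr rfl fun j _ => ?_
    ring
  simp only [h]
  rw [integral_finsetSum _ fun i _ => sph_integrable hn _ (by fun_prop), ← Finset.sum_neg_distrib]
  refine Finset.sum_congr rfl fun i _ => ?_
  rw [integral_finsetSum _ fun i _ => sph_integrable hn _ (by fun_prop), ← Finset.sum_neg_distrib]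
  refine Finset.sum_congr rfl fun j _ => ?_
  rw [integral_const_mul, integral_sub (sph_integrable hn _ (by fun_prop))
    (sph_integrable hn _ (by fun_prop)), sph_isotropy hn, hKb]
  ring

lemma trace_calc {n : ℕ} (A Kb : Matrix (Fin n) (Fin n) ℝ) (c : ℝ) (hs : Kbᵀ = Kb) :
    ∑ i, ∑ j, ((c • Kb) * A + A * (c • Kb)ᵀ) i j * Kb i j = 2 * c * (Kb * A * Kbᵀ).trace := by
  have h : ∑ i, ∑ j, ((c • Kb) * A + A * (c • Kb)ᵀ) i j * Kb i j =
      (((c • Kb) * A + A * (c • Kb)ᵀ) * Kbᵀ).trace := by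
    simp only [Matrix.trace, Matrix.diag, Matrix.mul_apply (N := Kbᵀ), Matrix.transpose_apply]
  rw [h, transpose_smul, hs, add_mul, trace_add]
  simp only [smul_mul, Matrix.mul_smul, trace_smul, smul_eq_mul]
  rw [trace_mul_comm (A * Kb) Kb, Matrix.mul_assoc Kb A Kb]
  ring

/-- Along the mean/covariance dynamics induced by the ideal sliced controller, the squared
sliced Wasserstein distance
`f(t) = ∫ [(θᵀ(m(t)−m_f))² + (√(θᵀΣ(t)θ) − √(θᵀΣ_fθ))²] dσ(θ)` is differentiable on
`[0,T)` with `f′(t) = −(2/(T−t)) [tr(K̄(t)Σ(t)K̄(t)ᵀ) + (1/n²)‖m(t)−m_f‖²]`. -/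
theorem sliced_SW2_derivative
    (n : ℕ) (hn : 1 ≤ n) (T : ℝ) (hT : 0 < T)
    (mf : EuclideanSpace ℝ (Fin n))
    (Sf : Matrix (Fin n) (Fin n) ℝ) (hSf : Sf.PosDef)
    (m : ℝ → EuclideanSpace ℝ (Fin n))
    (S : ℝ → Matrix (Fin n) (Fin n) ℝ)
    (hpos : ∀ t ∈ Set.Ico (0 : ℝ) T, (S t).PosDef)
    (Kb : ℝ → Matrix (Fin n) (Fin n) ℝ)
    (hKb : ∀ t ∈ Set.Ico (0 : ℝ) T, ∀ i j : Fin n,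
      Kb t i j =
        (∫ θ : sphere (0 : EuclideanSpace ℝ (Fin n)) 1,
            Real.sqrt (squad Sf θ / squad (S t) θ) *
              ((θ : EuclideanSpace ℝ (Fin n)) i * (θ : EuclideanSpace ℝ (Fin n)) j)
            ∂(sphereUniform n))
          - (1 / (n : ℝ)) * (if i = j then 1 else 0))
    (K : ℝ → Matrix (Fin n) (Fin n) ℝ)
    (hKdef : ∀ t ∈ Set.Ico (0 : ℝ) T, K t = (1 / (T - t)) • Kb t)
    (hm : ∀ t ∈ Set.Ico (0 : ℝ) T,
      HasDerivWithinAt m (-(1 / ((n : ℝ) * (T - t))) • (m t - mf)) (Set.Ico (0 : ℝ) T) t)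
    (hS : ∀ t ∈ Set.Ico (0 : ℝ) T, ∀ i j : Fin n,
      HasDerivWithinAt (fun s => S s i j)
        ((K t * S t + S t * (K t)ᵀ) i j) (Set.Ico (0 : ℝ) T) t) :
    ∀ t ∈ Set.Ico (0 : ℝ) T,
      HasDerivWithinAt
        (fun s => ∫ θ : sphere (0 : EuclideanSpace ℝ (Fin n)) 1,
          (sprj θ (m s - mf)) ^ 2 +
            (Real.sqrt (squad (S s) θ) - Real.sqrt (squad Sf θ)) ^ 2
          ∂(sphereUniform n))
        (-(2 / (T - t)) *
          ((Kb t * S t * (Kb t)ᵀ).trace + (1 / (n : ℝ) ^ 2) * ‖m t - mf‖ ^ 2))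
        (Set.Ico (0 : ℝ) T) t := by
  intro t ht
  have hTt : T - t ≠ 0 := by have := ht.2; intro h; linarith
  have hn0 : (n : ℝ) ≠ 0 := by positivity
  have hsym : (Kb t)ᵀ = Kb t := by
    ext i j
    rw [transpose_apply, hKb t ht, hKb t ht]
    simp only [mul_comm, eq_comm]
  have hcov := cov_deriv hn S _ Sf _ t ht hpos (hS t ht)
  rw [cov_integral hn (S t) _ Sf (Kb t) (hpos t ht) hSf (hKb t ht), hKdef t ht,
    trace_calc _ _ _ hsym] at hcov
  have hmean := (((hm t ht).sub_const mf).norm_sq).const_mul (1 / (n : ℝ))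
  have hsum := hmean.add hcov
  have hfun : (fun s => ∫ θ : sphere (0 : EuclideanSpace ℝ (Fin n)) 1,
          (sprj θ (m s - mf)) ^ 2 +
            (Real.sqrt (squad (S s) θ) - Real.sqrt (squad Sf θ)) ^ 2
          ∂(sphereUniform n)) = fun s => (1 / (n : ℝ)) * ‖m s - mf‖ ^ 2 +
        ∫ θ : sphere (0 : EuclideanSpace ℝ (Fin n)) 1,
          (√(squad (S s) θ) - √(squad Sf θ)) ^ 2 ∂(sphereUniform n) := by
    funext s
    rw [integral_add, sum_isotropy hn]
    · exact sph_integrable hn _ (by unfold sprj; fun_prop)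
    · exact sph_integrable hn _ (((squad_cont _).sqrt.sub (squad_cont _).sqrt).pow 2)
  rw [hfun]
  refine hsum.congr_deriv ?_
  rw [inner_smul_right, real_inner_self_eq_norm_sq]
  field_simp
  ring
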